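/- Let n ≥ 3 be an integer. There is no twice differentiable function w : ℝ → ℝ which is monotone nondecreasing, satisfies w''(t) − (n−2)·w'(t) + exp(−2t + exp(w(t))) = 0 for all t ∈ ℝ, and has a finite limit L = lim_{t→−∞} w(t). -/

import Mathlib

/-- there is no twice differentiable, monotone nondecreasing global
solution of `w'' - (n-2) w' + exp(-2t + e^w) = 0` on `ℝ` having a finite limit as
`t → -∞`. -/
theorem no_global_bounded_solution (n : ℕ) (hn : 3 ≤ n) :
    ¬ ∃ w : ℝ → ℝ,
        Differentiable ℝ w ∧ Differentiable ℝ (deriv w) ∧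
        Monotone w ∧
        (∀ t : ℝ, deriv (deriv w) t - ((n : ℝ) - 2) * deriv w t
            + Real.exp (-2 * t + Real.exp (w t)) = 0) ∧
        (∃ L : ℝ, Filter.Tendsto w Filter.atBot (nhds L)) := by
  rintro ⟨w, hw, hw', hmono, hode, L, hL⟩
  have hLw : ∀ t, L ≤ w t := fun t => hmono.le_of_tendsto hL t
  have hc : (0 : ℝ) ≤ (n : ℝ) - 2 := by
    have : (3 : ℝ) ≤ n := by exact_mod_cast hn
    linarith
  set c : ℝ := (n : ℝ) - 2
  have hg : ∀ t, HasDerivAt (fun t => deriv w t - c * w t - t ^ 2)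
      (deriv (deriv w) t - c * deriv w t - 2 * t) t := fun t =>
    (((hw' t).hasDerivAt.sub ((hw t).hasDerivAt.const_mul c)).sub
      (hasDerivAt_pow 2 t)).congr_deriv (by norm_num)
  have hanti : Antitone (fun t => deriv w t - c * w t - t ^ 2) := by
    refine antitone_of_deriv_nonpos (fun t => (hg t).differentiableAt) fun t => ?_
    rw [(hg t).deriv]
    have := Real.add_one_le_exp (-2 * t + Real.exp (w t))
    linarith [hode t, Real.exp_pos (w t)]
  set K : ℝ := deriv w 0 - c * w 0 + c * L
  have hlow : ∀ t ≤ 0, K + t ^ 2 ≤ deriv w t := fun t ht => by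
    have h := hanti ht
    have := mul_le_mul_of_nonneg_left (hLw t) hc
    simp only [K]
    norm_num at h
    linarith
  have hh : ∀ t, HasDerivAt (fun t => w t - K * t - t ^ 3 / 3)
      (deriv w t - K - t ^ 2) t := fun t =>
    (((hw t).hasDerivAt.sub ((hasDerivAt_id t).const_mul K)).sub
      ((hasDerivAt_pow 3 t).div_const 3)).congr_deriv (by norm_num)
  have hmonoOn : MonotoneOn (fun t => w t - K * t - t ^ 3 / 3) (Set.Iic 0) := by
    refine monotoneOn_of_deriv_nonneg (convex_Iic 0)
      (fun t _ => (hh t).continuousAt.continuousWithinAt)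
      (fun t _ => (hh t).differentiableAt.differentiableWithinAt) fun t ht => ?_
    rw [interior_Iic] at ht
    rw [(hh t).deriv]
    linarith [hlow t (le_of_lt ht)]
  have hbound : ∀ s, 0 ≤ s → K * s + s ^ 3 / 3 ≤ w 0 - L := fun s hs => by
    have h := hmonoOn (a := -s) (b := 0) (by simpa using hs) (by simp) (by simpa using hs)
    norm_num at h
    have h3 : (-s) ^ 3 = -s ^ 3 := by ring
    rw [h3] at h
    linarith [hLw (-s)]
  have hD : 0 ≤ w 0 - L := sub_nonneg.2 (hLw 0)
  set D : ℝ := w 0 - L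
  have hs : 0 ≤ 3 + |K| + D := by positivity
  have h := hbound (3 + |K| + D) hs
  have hK := neg_abs_le K
  set s : ℝ := 3 + |K| + D
  have hsq : 1 ≤ K + s ^ 2 / 3 := by nlinarith [abs_nonneg K]
  nlinarith [abs_nonneg K]
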